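/- The group Γ_c(𝒢(Γ,T)) of color respecting automorphisms of the Cayley graph 𝒢(Γ,T) is the internal semidirect product of Γ̂ and Aut(Γ,T): Γ̂ is a normal subgroup of Γ_c(𝒢(Γ,T)), Γ̂ ∩ Aut(Γ,T) is trivial, and every element of Γ_c(𝒢(Γ,T)) is a product of an element of Γ̂ and an element of Aut(Γ,T). In particular Γ_c(𝒢(Γ,T)) is isomorphic to the semidirect product Γ ⋊ Aut(Γ,T). -/

import Mathlib

open SimpleGraph

variable {Γ : Type*} [Group Γ]

/-- The Cayley graph of `Γ` with respect to a set `T` of involutory generators: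
`u` and `v` are adjacent iff `v = τ * u` for some `τ ∈ T`. -/
def cayleyGraph (T : Set Γ) : SimpleGraph Γ :=
  SimpleGraph.fromRel (fun u v => ∃ τ ∈ T, v = τ * u)

/-- The color of the edge `{u, v}` of the Cayley graph: the generator `v * u⁻¹`. -/
def cayleyColor (u v : Γ) : Γ := v * u⁻¹

/-- A graph automorphism `γ` of the Cayley graph is color respecting if any two edges
with the same color are mapped to edges with the same color. -/
def CayleyColorResp (T : Set Γ) (γ : cayleyGraph T ≃g cayleyGraph T) : Prop :=
  ∀ u v u' v' : Γ, (cayleyGraph T).Adj u v → (cayleyGraph T).Adj u' v' →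
    cayleyColor u v = cayleyColor u' v' →
    cayleyColor (γ u) (γ v) = cayleyColor (γ u') (γ v')

theorem cayleyGraph_adj_iff {Γ : Type*} [Group Γ] {T : Set Γ}
    (hinv : ∀ τ ∈ T, τ * τ = 1) (hne : ∀ τ ∈ T, τ ≠ 1) (u v : Γ) :
    (cayleyGraph T).Adj u v ↔ v * u⁻¹ ∈ T := by
  rw [cayleyGraph, SimpleGraph.fromRel_adj]
  constructor
  · rintro ⟨-, ⟨τ, hτ, rfl⟩ | ⟨τ, hτ, rfl⟩⟩
    · simpa using hτ
    · rw [mul_inv_rev, mul_inv_cancel_left, inv_eq_of_mul_eq_one_left (hinv τ hτ)]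
      exact hτ
  · intro h
    refine ⟨?_, Or.inl ⟨_, h, by simp⟩⟩
    rintro rfl
    exact hne _ h (mul_inv_cancel u)

/-- A color respecting automorphism is a group automorphism preserving `T`, followed by
a right translation. -/
theorem CayleyColorResp.exists_mulEquiv {Γ : Type*} [Group Γ] {T : Set Γ}
    (hinv : ∀ τ ∈ T, τ * τ = 1) (hne : ∀ τ ∈ T, τ ≠ 1)
    (hgen : Subgroup.closure T = ⊤)
    {γ : cayleyGraph T ≃g cayleyGraph T} (hγ : CayleyColorResp T γ) :
    ∃ (g : Γ) (d : Γ ≃* Γ), ⇑d '' T = T ∧ ∀ u : Γ, γ u = d u * g := by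
  have hadj := cayleyGraph_adj_iff hinv hne
  have hgenerator (τ : Γ) (hτ : τ ∈ T) (u : Γ) : γ (τ * u) = γ τ * (γ 1)⁻¹ * γ u := by
    have h := hγ u (τ * u) 1 τ ((hadj _ _).2 (by simpa using hτ))
      ((hadj _ _).2 (by simpa using hτ)) (by simp [cayleyColor])
    exact mul_inv_eq_iff_eq_mul.1 h
  have hmul (w : Γ) : ∀ u : Γ, γ (w * u) = γ w * (γ 1)⁻¹ * γ u := by
    have hw : w ∈ Subgroup.closure T := hgen ▸ Subgroup.mem_top w
    induction hw using Subgroup.closure_induction with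
    | mem x hx => exact hgenerator x hx
    | one => simp
    | mul x y _ _ hx hy =>
      intro u
      rw [mul_assoc, hx, hy, hx y]
      simp only [mul_assoc]
    | inv x _ hx =>
      intro u
      have hxu := hx (x⁻¹ * u)
      have hx1 := hx x⁻¹
      rw [mul_inv_cancel_left] at hxu
      rw [mul_inv_cancel] at hx1
      rw [hxu, ← mul_assoc, mul_assoc (γ x⁻¹), ← mul_assoc (γ 1)⁻¹]
      rw [eq_comm, ← eq_inv_mul_iff_mul_eq] at hx1
      rw [hx1]
      group
  refine ⟨γ 1, MulEquiv.mk (γ.toEquiv.trans (Equiv.mulRight (γ 1)⁻¹)) fun u v => ?_, ?_,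
    fun u => ?_⟩
  · change γ (u * v) * (γ 1)⁻¹ = γ u * (γ 1)⁻¹ * (γ v * (γ 1)⁻¹)
    rw [hmul, mul_assoc]
  · ext t
    change (∃ τ, τ ∈ T ∧ γ τ * (γ 1)⁻¹ = t) ↔ t ∈ T
    constructor
    · rintro ⟨τ, hτ, rfl⟩
      rw [← hadj, γ.map_adj_iff, hadj]
      simpa using hτ
    · intro ht
      refine ⟨γ.symm (t * γ 1), ?_, by simp⟩
      have h : (cayleyGraph T).Adj 1 (γ.symm (t * γ 1)) := by
        rw [← γ.map_adj_iff, hadj]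
        simpa using ht
      simpa using (hadj _ _).1 h
  · change γ u = γ u * (γ 1)⁻¹ * γ 1
    simp

/-- the group `Γ_c(𝒢(Γ,T))` of color respecting automorphisms of the Cayley
graph is the internal semidirect product of `Γ̂` and `Aut(Γ,T)`: the subgroup `Γ̂` is
normal, `Γ̂ ∩ Aut(Γ,T)` is trivial, and every color respecting automorphism is a product
of an element of `Γ̂` and an element of `Aut(Γ,T)`; thus `Γ_c(𝒢(Γ,T)) ≅ Γ ⋊ Aut(Γ,T)`. -/
theorem cayley_color_respecting_semidirect_product
    {Γ : Type*} [Group Γ] [Fintype Γ] (T : Set Γ)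
    (hinv : ∀ τ ∈ T, τ * τ = 1) (hne : ∀ τ ∈ T, τ ≠ 1)
    (hgen : Subgroup.closure T = ⊤) :
    (∀ γ : cayleyGraph T ≃g cayleyGraph T, CayleyColorResp T γ →
      ∀ g : Γ, ∃ g' : Γ, ∀ u : Γ, γ (γ.symm u * g⁻¹) = u * g'⁻¹) ∧
    (∀ (g : Γ) (d : Γ ≃* Γ), ⇑d '' T = T → (∀ u : Γ, d u = u * g⁻¹) →
      g = 1 ∧ ∀ u : Γ, d u = u) ∧
    (∀ γ : cayleyGraph T ≃g cayleyGraph T, CayleyColorResp T γ →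
      ∃ (g : Γ) (d : Γ ≃* Γ), ⇑d '' T = T ∧ ∀ u : Γ, γ u = d u * g) := by
  refine ⟨fun γ hγ h => ?_, fun g d _ hd => ?_,
    fun γ hγ => hγ.exists_mulEquiv hinv hne hgen⟩
  · obtain ⟨g, d, -, hd⟩ := hγ.exists_mulEquiv hinv hne hgen
    refine ⟨g⁻¹ * d h * g, fun u => ?_⟩
    have hu : d (γ.symm u) = u * g⁻¹ := by
      rw [eq_mul_inv_iff_mul_eq, ← hd, RelIso.apply_symm_apply]
    rw [hd, map_mul, hu, map_inv]
    group
  · have hg : g = 1 := by simpa using hd 1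
    exact ⟨hg, fun u => by simpa [hg] using hd u⟩
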